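/- For every d ≥ 0 and every x ∈ {0,1}^(4^d), the average choice complexity is at most the fault complexity: C(x) ≤ F(x). -/

import Mathlib

open scoped ENNReal
open scoped Classical

namespace NandTree

/-- The bit-`b` half of an input of length `2^(m+1)`: `b = false` gives the first half,
`b = true` the second half (lexicographic indexing, first bit most significant). -/
def halfInput (m : ℕ) (b : Bool) (x : Fin (2^(m+1)) → Bool) : Fin (2^m) → Bool :=
  fun i => x ⟨(cond b 1 0) * 2^m + i.val, by
    have h := i.isLt
    have h2 : (2:ℕ)^(m+1) = 2^m * 2 := pow_succ 2 m
    cases b <;> simp only [cond_true, cond_false] <;> omega⟩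

/-- The value `NAND_ℓ(x)` of a depth-`ℓ` NAND-tree instance: internal nodes at even
distance from the leaves are OR gates, at odd distance AND gates. -/
def nand : (ℓ : ℕ) → (Fin (2^ℓ) → Bool) → Bool
  | 0, x => x ⟨0, by norm_num⟩
  | (ℓ+1), x =>
    if (ℓ+1) % 2 = 0 then
      nand ℓ (halfInput ℓ false x) || nand ℓ (halfInput ℓ true x)
    else
      nand ℓ (halfInput ℓ false x) && nand ℓ (halfInput ℓ true x)

/-- Index of a leaf given by a root-to-leaf bit string (lexicographic, first bit most
significant). -/
def leafIdx (s : List Bool) : ℕ := s.foldl (fun n b => 2 * n + cond b 1 0) 0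

/-- The value of the leaf reached by bit string `s` in instance `x`. -/
def leafVal (m : ℕ) (x : Fin (2^m) → Bool) (s : List Bool) : Bool :=
  if h : leafIdx s < 2^m then x ⟨leafIdx s, h⟩ else false

/-- The root-to-leaf path determined by strategies `σA`, `σB` (each assigning a choice of
child to every node, nodes being given by the list of choices from the root): at a node
at distance `m+1` from the leaves, Player A chooses a child if `m+1` is even, else
Player B chooses. -/
def gamePath (σA σB : List Bool → Bool) : (m : ℕ) → List Bool → List Bool
  | 0, p => p
  | (m+1), p => gamePath σA σB m (p ++ [if (m+1) % 2 = 0 then σA p else σB p])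

/-- `winning Z m x σ`: strategy `σ` is a winning strategy for player `Z` (`true` = A,
`false` = B) in the two-player game on the depth-`m` instance `x`: against every
opponent strategy, the reached leaf has value `Z` (A wins on `1 = true`, B on
`0 = false`). -/
def winning (Z : Bool) (m : ℕ) (x : Fin (2^m) → Bool) (σ : List Bool → Bool) : Prop :=
  ∀ τ : List Bool → Bool,
    leafVal m x (gamePath (if Z then σ else τ) (if Z then τ else σ) m []) = Z

mutual

/-- The criticality `c(v)` of the root of a depth-`m` subtree with input `y`. -/
noncomputable def crit : (m : ℕ) → (Fin (2^m) → Bool) → ℝ≥0∞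
  | 0, _ => 1
  | 1, y => if y ⟨0, by norm_num⟩ = y ⟨1, by norm_num⟩ then 1 else 2
  | (m+2), y =>
    if nand (m+2) y ≠ decide ((m+2) % 2 = 0) then 1
    else if nand (m+1) (halfInput (m+1) false y) ≠ nand (m+1) (halfInput (m+1) true y) then 2
    else
      (max (CZ (decide ((m+2) % 2 = 0)) m (halfInput m false (halfInput (m+1) false y)) +
            CZ (decide ((m+2) % 2 = 0)) m (halfInput m true (halfInput (m+1) false y)))
           (CZ (decide ((m+2) % 2 = 0)) m (halfInput m false (halfInput (m+1) true y)) +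
            CZ (decide ((m+2) % 2 = 0)) m (halfInput m true (halfInput (m+1) true y)))) /
      (((CZ (decide ((m+2) % 2 = 0)) m (halfInput m false (halfInput (m+1) false y)) +
         CZ (decide ((m+2) % 2 = 0)) m (halfInput m true (halfInput (m+1) false y))) +
        ((CZ (decide ((m+2) % 2 = 0)) m (halfInput m false (halfInput (m+1) true y)) +
          CZ (decide ((m+2) % 2 = 0)) m (halfInput m true (halfInput (m+1) true y))))) / 2)
termination_by m _ => (m, 0)

/-- The expected product, over the random choices of `Z`'s opponent, of the criticalities
of the nodes at which `Z` moves along the path played according to strategy `σ`. -/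
noncomputable def pathProd (Z : Bool) :
    (σ : List Bool → Bool) → (m : ℕ) → (Fin (2^m) → Bool) → ℝ≥0∞
  | _, 0, _ => 1
  | σ, (m+1), y =>
    if decide ((m+1) % 2 = 0) = Z then
      crit (m+1) y * pathProd Z (fun q => σ (σ [] :: q)) m (halfInput m (σ []) y)
    else
      (pathProd Z (fun q => σ (false :: q)) m (halfInput m false y) +
       pathProd Z (fun q => σ (true :: q)) m (halfInput m true y)) / 2
termination_by _ m _ => (m, 1)

/-- The average choice complexity `C_Z` of a depth-`m` instance `y` for player `Z`
(`true` = A, `false` = B): the infimum, over `Z`-winning strategies, of the expected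
product of criticalities over the nodes where `Z` moves (and `∞` if `Z` has no winning
strategy, the infimum over the empty set being `⊤`). -/
noncomputable def CZ (Z : Bool) (m : ℕ) (y : Fin (2^m) → Bool) : ℝ≥0∞ :=
  ⨅ σ ∈ {σ : List Bool → Bool | winning Z m y σ}, pathProd Z σ m y
termination_by (m, 2)

end

/-- `ZWinPath Z m y p`: the root-to-leaf path `p` is a `Z`-winning path in the depth-`m`
instance `y`: the reached leaf is won by `Z`, and at every node of the path where `Z`
moves, the chosen child's subtree is `Z`-winnable. -/
def ZWinPath (Z : Bool) : (m : ℕ) → (Fin (2^m) → Bool) → List Bool → Prop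
  | 0, y, p => p = [] ∧ y ⟨0, by norm_num⟩ = Z
  | (_+1), _, [] => False
  | (m+1), y, b :: p =>
    (decide ((m+1) % 2 = 0) = Z → nand m (halfInput m b y) = Z) ∧
    ZWinPath Z m (halfInput m b y) p

/-- The number of fault nodes among the nodes of the path `p` at which `Z` moves (a node
is a fault if its two children's subtrees have different NAND values). -/
def faultCount (Z : Bool) : (m : ℕ) → (Fin (2^m) → Bool) → List Bool → ℕ
  | 0, _, _ => 0
  | (_+1), _, [] => 0
  | (m+1), y, b :: p =>
    (if decide ((m+1) % 2 = 0) = Z ∧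
        nand m (halfInput m false y) ≠ nand m (halfInput m true y)
     then 1 else 0) + faultCount Z m (halfInput m b y) p

/-- The fault complexity `F_Z`: the maximum of `2 ^ (number of faults at Z's nodes)` over
all `Z`-winning paths, and `∞` if the instance is not `Z`-winnable. -/
noncomputable def FZ (Z : Bool) (m : ℕ) (y : Fin (2^m) → Bool) : ℝ≥0∞ :=
  if nand m y = Z then
    ⨆ p ∈ {p : List Bool | ZWinPath Z m y p}, (2:ℝ≥0∞) ^ faultCount Z m y p
  else ⊤


theorem gamePath_cons (b : Bool) (m : ℕ) : ∀ (σA σB : List Bool → Bool) (p : List Bool),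
    gamePath σA σB m (b :: p) =
      b :: gamePath (fun q => σA (b :: q)) (fun q => σB (b :: q)) m p := by
  induction m with
  | zero => intros; rfl
  | succ m ih =>
    intro σA σB p
    simp only [gamePath, List.cons_append]
    rw [ih]

theorem gamePath_length (m : ℕ) : ∀ (σA σB : List Bool → Bool) (p : List Bool),
    (gamePath σA σB m p).length = p.length + m := by
  induction m with
  | zero => intros; rfl
  | succ m ih =>
    intro σA σB p
    simp only [gamePath]
    rw [ih]
    simp
    omega

theorem leafIdx_aux (s : List Bool) : ∀ n : ℕ,
    s.foldl (fun n b => 2 * n + cond b 1 0) n = n * 2 ^ s.length + leafIdx s := by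
  induction s with
  | nil => intro n; simp [leafIdx]
  | cons b s ih =>
    intro n
    simp only [leafIdx, List.foldl_cons, List.length_cons]
    rw [ih, ih (2 * 0 + cond b 1 0)]
    ring

theorem leafIdx_cons (b : Bool) (s : List Bool) :
    leafIdx (b :: s) = (cond b 1 0) * 2 ^ s.length + leafIdx s := by
  have := leafIdx_aux s (2 * 0 + cond b 1 0)
  simpa [leafIdx] using this

theorem leafIdx_lt (s : List Bool) : leafIdx s < 2 ^ s.length := by
  induction s with
  | nil => simp [leafIdx]
  | cons b s ih =>
    rw [leafIdx_cons, List.length_cons, pow_succ]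
    cases b <;> simp only [cond_true, cond_false] <;> omega

theorem leafVal_cons (m : ℕ) (x : Fin (2^(m+1)) → Bool) (b : Bool) (s : List Bool)
    (hs : s.length = m) : leafVal (m+1) x (b :: s) = leafVal m (halfInput m b x) s := by
  subst hs
  have h1 := leafIdx_lt s
  have h2 := leafIdx_lt (b :: s)
  rw [List.length_cons] at h2
  rw [leafVal, leafVal, dif_pos h1, dif_pos h2, halfInput]
  congr 1
  simp only [Fin.mk.injEq]
  exact leafIdx_cons b s

theorem winning_move (Z : Bool) (m : ℕ) (y : Fin (2^(m+1)) → Bool)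
    (hZ : decide ((m+1) % 2 = 0) = Z) (σ : List Bool → Bool)
    (h : winning Z m (halfInput m (σ []) y) (fun q => σ (σ [] :: q))) :
    winning Z (m+1) y σ := by
  intro τ
  have h' := h (fun q => τ (σ [] :: q))
  have hb : (if (m+1) % 2 = 0 then (if Z then σ else τ) [] else (if Z then τ else σ) [])
      = σ [] := by
    subst hZ
    by_cases hm : (m+1) % 2 = 0 <;> simp [hm]
  simp only [gamePath, List.nil_append]
  rw [hb, gamePath_cons, leafVal_cons]
  · refine Eq.trans ?_ h'
    cases Z <;> rfl
  · simp [gamePath_length]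

theorem winning_opp (Z : Bool) (m : ℕ) (y : Fin (2^(m+1)) → Bool)
    (σ : List Bool → Bool)
    (h : ∀ b, winning Z m (halfInput m b y) (fun q => σ (b :: q))) :
    winning Z (m+1) y σ := by
  intro τ
  simp only [gamePath, List.nil_append]
  generalize (if (m+1) % 2 = 0 then (if Z then σ else τ) [] else (if Z then τ else σ) []) = b
  have h' := h b (fun q => τ (b :: q))
  rw [gamePath_cons, leafVal_cons]
  · refine Eq.trans ?_ h'
    cases Z <;> rfl
  · simp [gamePath_length]

theorem CZ_le (Z : Bool) (m : ℕ) (y : Fin (2^m) → Bool) (σ : List Bool → Bool)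
    (h : winning Z m y σ) : CZ Z m y ≤ pathProd Z σ m y := by
  rw [CZ]
  exact iInf₂_le σ h

theorem crit_ne_top (m : ℕ) (y : Fin (2^m) → Bool) : crit m y ≠ ⊤ := by
  match m, y with
  | 0, y => simp [crit]
  | 1, y => rw [crit]; split_ifs <;> simp
  | (m+2), y =>
    rw [crit]
    split_ifs
    · simp
    · simp
    · refine ne_top_of_le_ne_top (b := 2) (by simp) ?_
      refine ENNReal.div_le_of_le_mul ?_
      rw [ENNReal.mul_div_cancel (by simp) (by simp)]
      exact max_le le_self_add le_add_self

theorem nand_opp (Z : Bool) (m : ℕ) (y : Fin (2^(m+1)) → Bool)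
    (hZ : ¬ decide ((m+1) % 2 = 0) = Z) (h : nand (m+1) y = Z) (b : Bool) :
    nand m (halfInput m b y) = Z := by
  rw [nand] at h
  by_cases hm : (m+1) % 2 = 0 <;> cases Z <;> cases b <;> simp_all

theorem nand_move (Z : Bool) (m : ℕ) (y : Fin (2^(m+1)) → Bool)
    (hZ : decide ((m+1) % 2 = 0) = Z) (h : nand (m+1) y = Z) :
    ∃ b, nand m (halfInput m b y) = Z := by
  rw [nand] at h
  by_cases hm : (m+1) % 2 = 0 <;> cases Z <;> simp_all
  cases h1 : nand m (halfInput m false y)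
  · exact Or.inl rfl
  · exact Or.inr (h h1)

theorem exists_winning (Z : Bool) (m : ℕ) : ∀ (y : Fin (2^m) → Bool), nand m y = Z →
    ∃ σ, winning Z m y σ := by
  induction m with
  | zero =>
    intro y h
    refine ⟨fun _ => true, fun τ => ?_⟩
    rw [← h]
    simp [gamePath, leafVal, leafIdx, nand]
  | succ m ih =>
    intro y h
    by_cases hZ : decide ((m+1) % 2 = 0) = Z
    · obtain ⟨b, hb⟩ := nand_move Z m y hZ h
      obtain ⟨σ, hσ⟩ := ih _ hb
      exact ⟨fun q => match q with
        | [] => b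
        | _ :: q => σ q, winning_move Z m y hZ _ hσ⟩
    · choose σ hσ using fun b => ih _ (nand_opp Z m y hZ h b)
      exact ⟨fun q => match q with
        | [] => true
        | b :: q => σ b q, winning_opp Z m y _ hσ⟩

theorem CZ_move (Z : Bool) (m : ℕ) (y : Fin (2^(m+1)) → Bool)
    (hZ : decide ((m+1) % 2 = 0) = Z) (b : Bool)
    (hb : nand m (halfInput m b y) = Z) :
    CZ Z (m+1) y ≤ crit (m+1) y * CZ Z m (halfInput m b y) := by
  have ht := crit_ne_top (m+1) y
  obtain ⟨σ₀, hσ₀⟩ := exists_winning Z m _ hb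
  haveI : Nonempty {σ : List Bool → Bool | winning Z m (halfInput m b y) σ} := ⟨⟨σ₀, hσ₀⟩⟩
  rw [CZ.eq_def Z m, iInf_subtype', ENNReal.mul_iInf (fun h => absurd h ht)]
  refine le_iInf fun ⟨σ, hσ⟩ => ?_
  let σ' : List Bool → Bool := fun q => match q with
    | [] => b
    | _ :: q => σ q
  refine (CZ_le Z (m+1) y σ' (winning_move Z m y hZ σ' hσ)).trans ?_
  rw [pathProd, if_pos hZ]

theorem CZ_opp (Z : Bool) (m : ℕ) (y : Fin (2^(m+1)) → Bool)
    (hZ : ¬ decide ((m+1) % 2 = 0) = Z) :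
    CZ Z (m+1) y ≤
      (CZ Z m (halfInput m false y) + CZ Z m (halfInput m true y)) / 2 := by
  rw [ENNReal.le_div_iff_mul_le (by simp) (by simp)]
  rw [CZ.eq_def Z m, CZ.eq_def Z m]
  refine ENNReal.le_iInf₂_add_iInf₂ fun σ hσ τ hτ => ?_
  rw [← ENNReal.le_div_iff_mul_le (by simp) (by simp)]
  let σ' : List Bool → Bool := fun q => match q with
    | [] => true
    | false :: q => σ q
    | true :: q => τ q
  have hw : winning Z (m+1) y σ' := by
    refine winning_opp Z m y σ' fun b => ?_
    cases b
    · exact hσ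
    · exact hτ
  refine (CZ_le Z (m+1) y σ' hw).trans ?_
  rw [pathProd, if_neg hZ]

theorem FZ_opp (Z : Bool) (m : ℕ) (y : Fin (2^(m+1)) → Bool)
    (hZ : ¬ decide ((m+1) % 2 = 0) = Z) (h : nand (m+1) y = Z) (b : Bool) :
    FZ Z m (halfInput m b y) ≤ FZ Z (m+1) y := by
  rw [FZ, FZ, if_pos h, if_pos (nand_opp Z m y hZ h b)]
  refine iSup₂_le fun p hp => ?_
  refine le_trans (le_of_eq ?_) (le_iSup₂ (b :: p) ?_)
  · simp [faultCount, hZ]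
  · exact ⟨fun h => absurd h hZ, hp⟩

theorem FZ_move (Z : Bool) (m : ℕ) (y : Fin (2^(m+1)) → Bool)
    (hZ : decide ((m+1) % 2 = 0) = Z) (h : nand (m+1) y = Z) (b : Bool)
    (hb : nand m (halfInput m b y) = Z) :
    (if nand m (halfInput m false y) ≠ nand m (halfInput m true y) then 2 else 1)
      * FZ Z m (halfInput m b y) ≤ FZ Z (m+1) y := by
  rw [FZ, FZ, if_pos h, if_pos hb]
  simp only [ENNReal.mul_iSup]
  refine iSup₂_le fun p hp => ?_
  refine le_trans (le_of_eq ?_) (le_iSup₂ (b :: p) ?_)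
  · simp only [faultCount, hZ, true_and, pow_add]
    congr 1
    split_ifs <;> simp
  · exact ⟨fun _ => hb, hp⟩

theorem crit_bound (a b : ℝ≥0∞) (F C : ℝ≥0∞) (ha : a / 2 ≤ F) (hb : b / 2 ≤ F)
    (h1 : C ≤ max a b / ((a + b) / 2) * (a / 2)) (h2 : C ≤ max a b / ((a + b) / 2) * (b / 2)) :
    C ≤ F := by
  have key : ∀ u v : ℝ≥0∞, u ≤ v → v / 2 ≤ F → v / ((u + v) / 2) * (u / 2) ≤ F := by
    intro u v huv hv
    have hu : u ≤ (u + v) / 2 := by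
      rw [ENNReal.le_div_iff_mul_le (by simp) (by simp), mul_two]
      gcongr
    calc v / ((u + v) / 2) * (u / 2) ≤ v / ((u + v) / 2) * ((u + v) / 2 / 2) := by gcongr
      _ = v / ((u + v) / 2) * ((u + v) / 2) / 2 := by rw [mul_div_assoc]
      _ ≤ v / 2 := by gcongr; rw [mul_comm]; exact ENNReal.mul_div_le
      _ ≤ F := hv
  rcases le_total a b with h | h
  · rw [max_eq_right h] at h1
    exact h1.trans (key a b h hb)
  · rw [max_eq_left h, add_comm a b] at h2
    exact h2.trans (key b a h ha)

theorem avg_le {a b F : ℝ≥0∞} (ha : a ≤ F) (hb : b ≤ F) : (a + b) / 2 ≤ F := by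
  refine ENNReal.div_le_of_le_mul ?_
  rw [mul_two]
  exact add_le_add ha hb

theorem CZ_zero (Z : Bool) (y : Fin (2^0) → Bool) (h : nand 0 y = Z) : CZ Z 0 y ≤ 1 := by
  refine (CZ_le Z 0 y (fun _ => true) ?_).trans (le_of_eq (by rw [pathProd]))
  intro τ
  rw [← h]
  simp [gamePath, leafVal, leafIdx, nand]

theorem FZ_zero (Z : Bool) (y : Fin (2^0) → Bool) (h : nand 0 y = Z) : 1 ≤ FZ Z 0 y := by
  rw [FZ, if_pos h]
  refine le_trans (le_of_eq ?_) (le_iSup₂ [] ?_)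
  · simp [faultCount]
  · exact ⟨rfl, h⟩

theorem CZ_le_FZ (m : ℕ) : ∀ (Z : Bool) (y : Fin (2^m) → Bool), nand m y = Z →
    CZ Z m y ≤ FZ Z m y := by
  induction m using Nat.strong_induction_on with
  | _ m ih =>
  match m, ih with
  | 0, _ => exact fun Z y h => (CZ_zero Z y h).trans (FZ_zero Z y h)
  | (m+1), ih =>
    intro Z y h
    by_cases hZ : decide ((m+1) % 2 = 0) = Z
    · obtain ⟨b, hb⟩ := nand_move Z m y hZ h
      have hF := fun b => FZ_move Z m y hZ h b
      by_cases hf : nand m (halfInput m false y) ≠ nand m (halfInput m true y)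
      · have hc : crit (m+1) y = 2 := by
          match m, y with
          | 0, y =>
            rw [crit, if_neg]
            simpa [nand, halfInput] using hf
          | (m+1), y =>
            rw [crit, if_neg (by rw [h, hZ]; simp), if_pos hf]
        have := hF b hb
        rw [if_pos hf] at this
        refine (CZ_move Z m y hZ b hb).trans (le_trans ?_ this)
        rw [hc]
        gcongr
        exact ih m (by omega) Z _ hb
      · simp only [if_neg hf, one_mul] at hF
        have hb' : ∀ b, nand m (halfInput m b y) = Z := by
          push Not at hf
          intro c
          cases b <;> cases c <;> simp_all
        match m, y with
        | 0, y =>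
          have hc : crit (0+1) y = 1 := by
            rw [crit, if_pos]
            simpa [nand, halfInput] using hf
          refine (CZ_move Z 0 y hZ b hb).trans (le_trans ?_ (hF b hb))
          rw [hc, one_mul]
          exact ih 0 (by omega) Z _ hb
        | (m+1), y =>
          have hZ' : ¬ decide ((m+1) % 2 = 0) = Z := by
            rw [← hZ]
            simp only [decide_eq_decide]
            omega
          have hC := fun b => CZ_opp Z m (halfInput (m+1) b y) hZ'
          have hG : ∀ b c, CZ Z m (halfInput m c (halfInput (m+1) b y)) ≤ FZ Z (m+2) y :=
            fun b c => (ih m (by omega) Z _ (nand_opp Z m _ hZ' (hb' b) c)).trans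
              ((FZ_opp Z m _ hZ' (hb' b) c).trans (hF b (hb' b)))
          have hM := fun b => (CZ_move Z (m+1) y hZ b (hb' b)).trans
            (mul_le_mul_right (hC b) _)
          rw [crit, if_neg (by rw [h, hZ]; simp), if_neg hf, hZ] at hM
          exact crit_bound _ _ _ _ (avg_le (hG false false) (hG false true))
            (avg_le (hG true false) (hG true true)) (hM false) (hM true)
    · exact (CZ_opp Z m y hZ).trans (avg_le
        ((ih m (by omega) Z _ (nand_opp Z m y hZ h _)).trans (FZ_opp Z m y hZ h _))
        ((ih m (by omega) Z _ (nand_opp Z m y hZ h _)).trans (FZ_opp Z m y hZ h _)))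

/-- The average choice complexity is at most the fault complexity:
`C(x) ≤ F(x)`. -/
theorem avgChoice_le_fault (d : ℕ) (x : Fin (2^(2*d)) → Bool) :
    min (CZ true (2*d) x) (CZ false (2*d) x)
      ≤ min (FZ true (2*d) x) (FZ false (2*d) x) := by
  refine le_min ?_ ?_
  · by_cases h : nand (2*d) x = true
    · exact (min_le_left _ _).trans (CZ_le_FZ _ _ _ h)
    · rw [FZ, if_neg h]; exact le_top
  · by_cases h : nand (2*d) x = false
    · exact (min_le_right _ _).trans (CZ_le_FZ _ _ _ h)
    · rw [FZ, if_neg h]; exact le_top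


end NandTree
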